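/- arXiv:2503.15780 — 3 statements merged into one kernel-verified Lean document; each statement's English description precedes it below -/
import Mathlib

section
/- Let λ ∈ ℂ and let f be a normalized analytic function on 𝔻 with f'(z) ≠ 0 for all z ∈ 𝔻, and suppose Re( 1 + λ·z·f''(z)/f'(z) ) > 0 for all z ∈ 𝔻. Let ℓ be analytic on 𝔻 with ℓ(0) = 0 and exp(ℓ(z)) = f'(z) for all z ∈ 𝔻, and define the Pfaltzgraff transform F(z) = P_λ(f)(z) = ∫₀^z exp( λ·ℓ(ζ) ) dζ (integral along the segment from 0 to z), i.e., F = ∫₀^z f'(ζ)^λ dζ. Then F is starlike: F(z) ≠ 0 and Re(z·F'(z)/F(z)) > 0 for all z ∈ 𝔻 \ {0}. -/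
open Complex Metric Set

/-- Integral along the segment from `0` to `z`: `∫₀ᶻ g(ζ) dζ = z • ∫₀¹ g(tz) dt`. -/
noncomputable def segIntegral (g : ℂ → ℂ) (z : ℂ) : ℂ :=
  z * ∫ t in (0:ℝ)..1, g ((t : ℂ) * z)

open Filter Topology ComplexConjugate

/-- A real function with negative derivative is strictly smaller just to the right. -/
lemma eventually_lt_of_hasDerivAt_neg {φ : ℝ → ℝ} {d x : ℝ} (h : HasDerivAt φ d x) (hd : d < 0) :
    ∀ᶠ t in 𝓝[>] x, φ t < φ x := by
  have h1 := (hasDerivAt_iff_tendsto_slope.1 h).mono_left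
    (nhdsWithin_mono x (fun t (ht : x < t) => ht.ne'))
  filter_upwards [h1.eventually_lt_const hd, self_mem_nhdsWithin] with t ht hxt
  have hxt' : 0 < t - x := sub_pos.2 hxt
  rw [slope_def_field, div_neg_iff] at ht
  rcases ht with ⟨_, h⟩ | ⟨h, _⟩ <;> linarith

/-- If `z H' = 1 - q H` on the unit disk and `Re q > 0`, then `Re H > 0`. -/
lemma re_pos_of_mul_deriv_eq {H dH q : ℂ → ℂ}
    (hH : ∀ z ∈ ball (0 : ℂ) 1, HasDerivAt H (dH z) z)
    (hode : ∀ z ∈ ball (0 : ℂ) 1, z * dH z = 1 - q z * H z)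
    (hq : ∀ z ∈ ball (0 : ℂ) 1, 0 < (q z).re) :
    ∀ z ∈ ball (0 : ℂ) 1, 0 < (H z).re := by
  intro w hw
  by_contra! hneg
  have hsub : closedBall (0 : ℂ) ‖w‖ ⊆ ball 0 1 :=
    closedBall_subset_ball (by simpa using hw)
  have hcont : ContinuousOn (fun z => (H z).re) (closedBall 0 ‖w‖) := fun z hz =>
    (continuous_re.continuousAt.comp (hH z (hsub hz)).continuousAt).continuousWithinAt
  have hcomp : IsCompact (closedBall (0 : ℂ) ‖w‖ ∩ (fun z => (H z).re) ⁻¹' Iic 0) :=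
    (isCompact_closedBall _ _).of_isClosed_subset
      (hcont.preimage_isClosed_of_isClosed isClosed_closedBall isClosed_Iic) inter_subset_left
  obtain ⟨z, ⟨hzb, hz⟩, hmin⟩ := hcomp.exists_isMinOn ⟨w, by simp, hneg⟩
    continuous_norm.continuousOn
  have hz0 : (H z).re ≤ 0 := hz
  have hzB := hsub hzb
  have hqz := hq z hzB
  have hdneg : (z * dH z * -conj (q z)).re < 0 := by
    rw [hode z hzB]
    simp only [mul_re, mul_im, sub_re, sub_im, neg_re, neg_im, conj_re, conj_im, one_re, one_im]
    nlinarith [mul_nonneg (add_nonneg (sq_nonneg (q z).re) (sq_nonneg (q z).im))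
      (neg_nonneg.2 hz0)]
  have hzne : z ≠ 0 := by
    rintro rfl
    simp at hdneg
  have hpath : HasDerivAt (fun t : ℝ => z * (1 - (t : ℂ) * conj (q z))) (z * -conj (q z)) 0 := by
    have := (((hasDerivAt_id (0 : ℝ)).ofReal_comp.mul_const (conj (q z))).const_sub 1).const_mul z
    simpa using this
  have hre : HasDerivAt (fun t : ℝ => (H (z * (1 - (t : ℂ) * conj (q z)))).re)
      (z * dH z * -conj (q z)).re 0 := by
    have h1 : HasDerivAt H (dH z) (z * (1 - ((0 : ℝ) : ℂ) * conj (q z))) := by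
      simpa using hH z hzB
    have h2 := reCLM.hasFDerivAt.comp_hasDerivAt (0 : ℝ) (h1.comp (0 : ℝ) hpath)
    have h3 : z * dH z * -conj (q z) = dH z * (z * -conj (q z)) := by ring
    rw [h3]
    exact h2
  have hsq : HasDerivAt (fun t : ℝ => normSq (1 - (t : ℂ) * conj (q z))) (-(2 * (q z).re)) 0 := by
    have h1 : HasDerivAt (fun t : ℝ => (1 - t * (q z).re) ^ 2 + (t * (q z).im) ^ 2)
        (-(2 * (q z).re)) 0 := by
      have := ((((hasDerivAt_id (0 : ℝ)).mul_const (q z).re).const_sub 1).pow 2).add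
        (((hasDerivAt_id (0 : ℝ)).mul_const (q z).im).pow 2)
      simpa [Pi.add_def, Pi.pow_def] using this
    refine h1.congr_of_eventuallyEq (Eventually.of_forall fun t => ?_)
    simp [normSq_apply]
    ring
  obtain ⟨t, ht1, ht2⟩ := ((eventually_lt_of_hasDerivAt_neg hre hdneg).and
    (eventually_lt_of_hasDerivAt_neg hsq (by linarith))).exists
  simp only [ofReal_zero, zero_mul, sub_zero, mul_one, map_one] at ht1 ht2
  have hlt : ‖z * (1 - (t : ℂ) * conj (q z))‖ < ‖z‖ := by
    rw [norm_mul]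
    refine mul_lt_of_lt_one_right (norm_pos_iff.2 hzne) ?_
    rw [normSq_eq_norm_sq] at ht2
    exact (sq_lt_one_iff₀ (norm_nonneg _)).1 ht2
  have hle : ‖z‖ ≤ ‖w‖ := by simpa using hzb
  exact hlt.not_ge (hmin ⟨by simpa using hlt.le.trans hle, ht1.le.trans hz0⟩)

/-- The segment integral of a holomorphic function on the unit disk is a primitive of it. -/
lemma hasDerivAt_segIntegral {g : ℂ → ℂ} (hg : DifferentiableOn ℂ g (ball 0 1)) :
    ∀ z ∈ ball (0 : ℂ) 1, HasDerivAt (segIntegral g) (g z) z := by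
  obtain ⟨G, hG⟩ := hg.isExactOn_ball
  have heq : ∀ z ∈ ball (0 : ℂ) 1, segIntegral g z = G z - G 0 := by
    intro z hz
    have hmem : ∀ t ∈ uIcc (0 : ℝ) 1, (t : ℂ) * z ∈ ball (0 : ℂ) 1 := by
      intro t ht
      rw [uIcc_of_le zero_le_one] at ht
      rw [mem_ball_zero_iff] at hz ⊢
      rw [norm_mul, norm_real, Real.norm_of_nonneg ht.1]
      exact (mul_le_of_le_one_left (norm_nonneg z) ht.2).trans_lt hz
    have hc : ContinuousOn (fun t : ℝ => g ((t : ℂ) * z)) (uIcc 0 1) :=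
      hg.continuousOn.comp (by fun_prop) hmem
    have hd : ∀ t ∈ uIcc (0 : ℝ) 1,
        HasDerivAt (fun t : ℝ => G ((t : ℂ) * z)) (z * g ((t : ℂ) * z)) t := by
      intro t ht
      have h1 := (hasDerivAt_id t).ofReal_comp.mul_const z
      have h2 := (hG _ (hmem t ht)).comp t h1
      simpa [mul_comm, Function.comp_def] using h2
    have := intervalIntegral.integral_eq_sub_of_hasDerivAt hd
      (hc.intervalIntegrable.const_mul z)
    rw [intervalIntegral.integral_const_mul] at this
    simpa [segIntegral] using this
  intro z hz
  refine ((hG z hz).sub_const (G 0)).congr_of_eventuallyEq ?_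
  filter_upwards [isOpen_ball.mem_nhds hz] with u hu using heq u hu

/-- A convex function is starlike: if `g` is holomorphic and nonvanishing on the unit disk with
`Re (1 + z g' / g) > 0`, then the primitive `F` of `g` with `F 0 = 0` is starlike. -/
lemma starlike_of_convex {F g : ℂ → ℂ} (hF0 : F 0 = 0)
    (hF : ∀ z ∈ ball (0 : ℂ) 1, HasDerivAt F (g z) z)
    (hg : DifferentiableOn ℂ g (ball 0 1)) (hg0 : ∀ z ∈ ball (0 : ℂ) 1, g z ≠ 0)
    (hconv : ∀ z ∈ ball (0 : ℂ) 1, 0 < (1 + z * deriv g z / g z).re) :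
    ∀ z ∈ ball (0 : ℂ) 1, z ≠ 0 → F z ≠ 0 ∧ 0 < (z * deriv F z / F z).re := by
  have hmul : ∀ z, F z = z * dslope F 0 z := fun z => by
    simpa [hF0] using (sub_smul_dslope F 0 z).symm
  have hDd : DifferentiableOn ℂ (dslope F 0) (ball 0 1) :=
    (differentiableOn_dslope (ball_mem_nhds 0 one_pos)).2
      fun z hz => (hF z hz).differentiableAt.differentiableWithinAt
  have hD : ∀ z ∈ ball (0 : ℂ) 1, HasDerivAt (dslope F 0) (deriv (dslope F 0) z) z :=
    fun z hz => (hDd.differentiableAt (isOpen_ball.mem_nhds hz)).hasDerivAt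
  have hgd : ∀ z ∈ ball (0 : ℂ) 1, HasDerivAt g (deriv g z) z :=
    fun z hz => (hg.differentiableAt (isOpen_ball.mem_nhds hz)).hasDerivAt
  have hpos := re_pos_of_mul_deriv_eq (fun z hz => (hD z hz).div (hgd z hz) (hg0 z hz))
    (q := fun z => 1 + z * deriv g z / g z) (fun z hz => ?_) hconv
  · intro z hz hz0
    have hp := hpos z hz
    have hinv : z * deriv F z / F z = (dslope F 0 z / g z)⁻¹ := by
      rw [(hF z hz).deriv, hmul z, mul_div_mul_left _ _ hz0, inv_div]
    have hne : dslope F 0 z / g z ≠ 0 := fun h => by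
      rw [Pi.div_apply, h] at hp
      simp at hp
    refine ⟨?_, ?_⟩
    · rw [hmul z]
      exact mul_ne_zero hz0 (div_ne_zero_iff.1 hne).1
    · rw [hinv, inv_re]
      exact div_pos hp (normSq_pos.2 hne)
  · have h1 : g z = dslope F 0 z + z * deriv (dslope F 0) z := by
      have h2 := ((hasDerivAt_id z).mul (hD z hz)).congr_of_eventuallyEq
        (Eventually.of_forall hmul)
      simpa using (hF z hz).unique h2
    have h3 := hg0 z hz
    simp only [Pi.div_apply]
    field_simp
    linear_combination (-g z) * h1

/-- For the Pfaltzgraff transform `P_λ(f)(z) = ∫₀ᶻ f'(ζ)^λ dζ`: if `f` is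
normalized analytic with `f' ≠ 0` and `Re(1 + λ z f''/f') > 0` on `𝔻`, then `P_λ(f)` is
starlike. -/
theorem pfaltzgraff_starlike (lam : ℂ)
    (f : ℂ → ℂ) (hf : AnalyticOnNhd ℂ f (ball 0 1)) (hf0 : f 0 = 0) (hf1 : deriv f 0 = 1)
    (hf' : ∀ z ∈ ball (0 : ℂ) 1, deriv f z ≠ 0)
    (hconv : ∀ z ∈ ball (0 : ℂ) 1,
      0 < (1 + lam * z * deriv (deriv f) z / deriv f z).re)
    (ℓ : ℂ → ℂ) (hℓa : AnalyticOnNhd ℂ ℓ (ball 0 1)) (hℓ0 : ℓ 0 = 0)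
    (hℓ : ∀ z ∈ ball (0 : ℂ) 1, Complex.exp (ℓ z) = deriv f z) :
    ∀ z ∈ ball (0 : ℂ) 1, z ≠ 0 →
      segIntegral (fun ζ => Complex.exp (lam * ℓ ζ)) z ≠ 0 ∧
        0 < (z * deriv (segIntegral (fun ζ => Complex.exp (lam * ℓ ζ))) z /
          segIntegral (fun ζ => Complex.exp (lam * ℓ ζ)) z).re := by
  have hℓd : ∀ z ∈ ball (0 : ℂ) 1, HasDerivAt ℓ (deriv ℓ z) z :=
    fun z hz => (hℓa z hz).differentiableAt.hasDerivAt
  have hgd : ∀ z ∈ ball (0 : ℂ) 1, HasDerivAt (fun ζ => Complex.exp (lam * ℓ ζ))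
      (Complex.exp (lam * ℓ z) * (lam * deriv ℓ z)) z :=
    fun z hz => ((hℓd z hz).const_mul lam).cexp
  have hg : DifferentiableOn ℂ (fun ζ => Complex.exp (lam * ℓ ζ)) (ball 0 1) :=
    fun z hz => (hgd z hz).differentiableAt.differentiableWithinAt
  refine starlike_of_convex (by simp [segIntegral]) (hasDerivAt_segIntegral hg) hg
    (fun z _ => Complex.exp_ne_zero _) fun z hz => ?_
  have hf2 : deriv (deriv f) z = deriv f z * deriv ℓ z := by
    have h1 : deriv f =ᶠ[𝓝 z] fun ζ => Complex.exp (ℓ ζ) := by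
      filter_upwards [isOpen_ball.mem_nhds hz] with u hu using (hℓ u hu).symm
    rw [h1.deriv_eq, (hℓd z hz).cexp.deriv, hℓ z hz]
  have h := hconv z hz
  rw [hf2] at h
  rw [(hgd z hz).deriv]
  convert h using 2
  have h1 := hf' z hz
  have h2 := Complex.exp_ne_zero (lam * ℓ z)
  field_simp
end

section
/- Let 0 ≤ α < 1 and let c ≥ 0 be an integer. If f is a normalized analytic function on 𝔻 that is starlike of order α, i.e., f(z) ≠ 0 and Re(z·f'(z)/f(z)) > α for all z ∈ 𝔻 \ {0}, then its Bernardi transform F = B_c(f) is also starlike of order α: F(z) ≠ 0 and Re(z·F'(z)/F(z)) > α for all z ∈ 𝔻 \ {0}. Hence B_c(S*(α)) ⊆ S*(α). -/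
open Complex Metric Set

/-- The integrand `ζ^(c-1) f(ζ) = ζ^c · (f(ζ)/ζ)`, with `f(ζ)/ζ` extended by `f'(0)` at `ζ = 0`. -/
noncomputable def bernardiIntegrand (c : ℕ) (f : ℂ → ℂ) (ζ : ℂ) : ℂ :=
  (if ζ = 0 then deriv f 0 else f ζ / ζ) * ζ ^ c

/-- The Bernardi transform `B_c(f)(z) = ((1+c)/z^c) ∫₀ᶻ ζ^(c-1) f(ζ) dζ`, with value `0` at `0`. -/
noncomputable def bernardi (c : ℕ) (f : ℂ → ℂ) (z : ℂ) : ℂ :=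
  if z = 0 then 0 else ((1 + c : ℂ) / z ^ c) * segIntegral (bernardiIntegrand c f) z

open scoped ComplexConjugate

/-- If the real part of `v` on the closed disk of radius `‖z₀‖` is maximal at `z₀`, then
`z₀ * v'(z₀)` is a nonnegative real number. -/
lemma exists_nonneg_mul_deriv_eq_of_re_le {v : ℂ → ℂ} {v' z₀ : ℂ} (hv : HasDerivAt v v' z₀)
    (hmax : ∀ z ∈ closedBall (0 : ℂ) ‖z₀‖, (v z).re ≤ (v z₀).re) :
    ∃ k : ℝ, 0 ≤ k ∧ z₀ * v' = k := by
  set A := z₀ * v' with hA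
  have hd : HasFDerivWithinAt (fun z => (v z).re)
      (reCLM.comp ((ContinuousLinearMap.toSpanSingleton ℂ v').restrictScalars ℝ))
      (closedBall 0 ‖z₀‖) z₀ :=
    (reCLM.hasFDerivAt.comp z₀ (hv.hasFDerivAt.restrictScalars ℝ)).hasFDerivWithinAt
  have hloc : IsLocalMaxOn (fun z => (v z).re) (closedBall 0 ‖z₀‖) z₀ :=
    IsMaxOn.localize fun z hz => hmax z hz
  have key : ∀ w : ℂ, ‖w‖ ≤ 1 → (A * w).re ≤ A.re := by
    intro w hw
    have hmem : w * z₀ ∈ closedBall (0 : ℂ) ‖z₀‖ := by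
      simpa using mul_le_of_le_one_left (norm_nonneg z₀) hw
    have hz₀ : z₀ ∈ closedBall (0 : ℂ) ‖z₀‖ := by simp
    have h := hloc.hasFDerivWithinAt_nonpos hd
      (sub_mem_posTangentConeAt_of_segment_subset
        ((convex_closedBall (0 : ℂ) ‖z₀‖).segment_subset hz₀ hmem))
    have h' : ((w * z₀ - z₀) * v').re ≤ 0 := by simpa using h
    have e : (w * z₀ - z₀) * v' = A * w - A := by rw [hA]; ring
    rw [e, sub_re] at h'
    linarith
  have hre : ‖A‖ ≤ A.re := by
    by_cases h0 : A = 0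
    · simp [h0]
    have hn : (‖A‖ : ℂ) ≠ 0 := by simpa using h0
    have h := key (conj A / ‖A‖) (by simp [h0])
    have e : A * (conj A / ‖A‖) = (‖A‖ : ℂ) := by
      rw [← mul_div_assoc, mul_conj', sq, mul_div_assoc, div_self hn, mul_one]
    rwa [e, ofReal_re] at h
  refine ⟨‖A‖, norm_nonneg A, ?_⟩
  exact eq_coe_norm_of_nonneg (re_eq_norm.mp (le_antisymm (re_le_norm A) hre))

/-- Solutions of `z u' + Q u = 1` with `Re Q > β` on the punctured disk satisfy
`β ‖u‖² < Re u`, that is, `u ≠ 0` and `Re (1 / u) > β`, as soon as this holds at `0`. -/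
lemma mul_normSq_lt_re_of_ode {β : ℝ} (hβ : 0 ≤ β) {u u' Q : ℂ → ℂ}
    (hcont : ContinuousOn u (ball 0 1))
    (hderiv : ∀ z ∈ ball (0 : ℂ) 1, z ≠ 0 → HasDerivAt u (u' z) z)
    (hode : ∀ z ∈ ball (0 : ℂ) 1, z ≠ 0 → z * u' z + Q z * u z = 1)
    (hQ : ∀ z ∈ ball (0 : ℂ) 1, z ≠ 0 → β < (Q z).re)
    (h0 : β * normSq (u 0) < (u 0).re) :
    ∀ z ∈ ball (0 : ℂ) 1, β * normSq (u z) < (u z).re := by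
  intro z₁ hz₁
  by_contra! hz₁'
  set ψ : ℂ → ℝ := fun z => β * normSq (u z) - (u z).re with hψ
  have hsub : ∀ {z : ℂ}, z ∈ ball (0 : ℂ) 1 → closedBall (0 : ℂ) ‖z‖ ⊆ ball 0 1 := by
    intro z hz
    exact closedBall_subset_ball (by simpa using hz)
  have hψc : ContinuousOn ψ (ball 0 1) :=
    (continuousOn_const.mul (continuous_normSq.comp_continuousOn hcont)).sub
      (continuous_re.comp_continuousOn hcont)
  obtain ⟨z₀, ⟨hz₀, hz₀'⟩, hmin⟩ :
      ∃ z₀ ∈ closedBall (0 : ℂ) ‖z₁‖ ∩ ψ ⁻¹' Ici 0,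
        IsMinOn (fun z : ℂ => ‖z‖) (closedBall (0 : ℂ) ‖z₁‖ ∩ ψ ⁻¹' Ici 0) z₀ := by
    refine IsCompact.exists_isMinOn ?_ ?_ continuous_norm.continuousOn
    swap
    · exact ⟨z₁, mem_closedBall_zero_iff.mpr le_rfl, sub_nonneg.mpr hz₁'⟩
    exact (isCompact_closedBall _ _).of_isClosed_subset
      ((hψc.mono (hsub hz₁)).preimage_isClosed_of_isClosed isClosed_closedBall isClosed_Ici)
      inter_subset_left
  have hz₀b : z₀ ∈ ball (0 : ℂ) 1 := hsub hz₁ hz₀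
  have hz₀ne : z₀ ≠ 0 := by
    rintro rfl
    have : (0 : ℝ) ≤ ψ 0 := hz₀'
    simp only [hψ] at this
    linarith
  have hlt : ∀ z ∈ ball (0 : ℂ) ‖z₀‖, ψ z ≤ 0 := by
    intro z hz
    by_contra! hpos
    have hzn : ‖z‖ < ‖z₀‖ := by simpa using hz
    have hz₀n : ‖z₀‖ ≤ ‖z₁‖ := by simpa using hz₀
    have : ‖z₀‖ ≤ ‖z‖ := isMinOn_iff.mp hmin z ⟨by simpa using (hzn.trans_le hz₀n).le, hpos.le⟩
    linarith
  have hle : ∀ z ∈ closedBall (0 : ℂ) ‖z₀‖, ψ z ≤ 0 := by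
    intro z hz
    have hc : closure (ball (0 : ℂ) ‖z₀‖) = closedBall 0 ‖z₀‖ :=
      closure_ball _ (by simpa using hz₀ne)
    rw [← hc] at hz
    refine le_on_closure hlt ?_ continuousOn_const hz
    rw [hc]
    exact hψc.mono (hsub hz₀b)
  have hψ₀ : ψ z₀ = 0 := le_antisymm (hle z₀ (by simp)) hz₀'
  set n : ℂ := 2 * β * conj (u z₀) - 1 with hn
  obtain ⟨k, hk, hkeq⟩ := exists_nonneg_mul_deriv_eq_of_re_le
    ((hderiv z₀ hz₀b hz₀ne).const_mul n) (by
      intro z hz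
      have h1 := hle z hz
      have h2 : 0 ≤ β * normSq (u z - u z₀) := mul_nonneg hβ (normSq_nonneg _)
      simp only [hψ, normSq_apply] at h1 h2 hψ₀
      simp [hn] at h2 ⊢
      nlinarith)
  have hode₀ := hode z₀ hz₀b hz₀ne
  have hQ₀ := hQ z₀ hz₀b hz₀ne
  have hnn : conj n * n = 1 := by
    simp only [hψ, normSq_apply] at hψ₀
    apply Complex.ext
    · simp [hn]
      linear_combination 4 * β * hψ₀
    · simp [hn]
      ring
  have hu' : z₀ * u' z₀ = k * conj n := by
    linear_combination conj n * hkeq - z₀ * u' z₀ * hnn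
  rw [hu'] at hode₀
  have e1 := congrArg re hode₀
  have e2 := congrArg im hode₀
  simp [hn] at e1 e2
  simp only [hψ, normSq_apply] at hψ₀
  generalize (u z₀).re = a at *
  generalize (u z₀).im = b at *
  generalize (Q z₀).re = p at *
  generalize (Q z₀).im = q at *
  have hs : (a * a + b * b) * (p - β + k * β) = 0 := by
    linear_combination a * e1 + b * e2 + (-1 - k) * hψ₀
  have hp : 0 < p - β + k * β := by nlinarith [mul_nonneg hk hβ]
  have hs0 : a * a + b * b = 0 := (mul_eq_zero.mp hs).resolve_right hp.ne'
  have ha : a = 0 := by nlinarith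
  have hb : b = 0 := by nlinarith
  subst ha hb
  simp at e1
  linarith

/-- The integral of a holomorphic function along segments from `0` is a primitive. -/
lemma hasDerivAt_segIntegral_s14 {G : ℂ → ℂ} (hG : DifferentiableOn ℂ G (ball 0 1)) {z : ℂ}
    (hz : z ∈ ball (0 : ℂ) 1) : HasDerivAt (segIntegral G) (G z) z := by
  obtain ⟨P, hP⟩ := hG.isExactOn_ball
  have hmem : ∀ w ∈ ball (0 : ℂ) 1, ∀ t ∈ uIcc (0 : ℝ) 1, (t : ℂ) * w ∈ ball (0 : ℂ) 1 := by
    intro w hw t ht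
    rw [uIcc_of_le zero_le_one] at ht
    have h1 : ‖w‖ < 1 := by simpa using hw
    simp only [mem_ball_zero_iff, norm_mul, norm_real, Real.norm_of_nonneg ht.1]
    nlinarith [ht.1, ht.2, norm_nonneg w]
  have hseg : ∀ w ∈ ball (0 : ℂ) 1, segIntegral G w = P w - P 0 := by
    intro w hw
    have hd : ∀ t ∈ uIcc (0 : ℝ) 1,
        HasDerivAt (fun t : ℝ => P ((t : ℂ) * w)) (w * G ((t : ℂ) * w)) t := by
      intro t ht
      have h1 : HasDerivAt (fun s : ℂ => s * w) w (t : ℂ) := by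
        simpa using (hasDerivAt_id (t : ℂ)).mul_const w
      have h2 := ((hP _ (hmem w hw t ht)).comp (t : ℂ) h1).comp_ofReal
      simpa [mul_comm] using h2
    have hc : ContinuousOn (fun t : ℝ => w * G ((t : ℂ) * w)) (uIcc 0 1) :=
      continuousOn_const.mul
        (hG.continuousOn.comp (by fun_prop) (hmem w hw))
    have := intervalIntegral.integral_eq_sub_of_hasDerivAt hd hc.intervalIntegrable
    rw [intervalIntegral.integral_const_mul] at this
    simpa [segIntegral] using this
  refine ((hP z hz).sub_const (P 0)).congr_of_eventuallyEq ?_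
  filter_upwards [isOpen_ball.mem_nhds hz] with w hw using hseg w hw

/-- Weighted averages of a continuous function over radii depend continuously on the endpoint. -/
lemma continuousOn_integral_radius {g : ℂ → ℂ} (hg : ContinuousOn g (ball 0 1)) (c : ℕ) :
    ContinuousOn (fun z : ℂ => ∫ t in (0 : ℝ)..1, g ((t : ℂ) * z) * (t : ℂ) ^ c) (ball 0 1) := by
  let p : ℝ → ℝ := fun t => projIcc (0 : ℝ) 1 zero_le_one t
  have hp : Continuous p := continuous_subtype_val.comp continuous_projIcc
  have hp01 : ∀ t, p t ∈ Icc (0 : ℝ) 1 := fun t => (projIcc (0 : ℝ) 1 zero_le_one t).2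
  have hmem : ∀ x : ball (0 : ℂ) 1 × ℝ, (p x.2 : ℂ) * x.1 ∈ ball (0 : ℂ) 1 := by
    intro x
    have h1 : ‖(x.1 : ℂ)‖ < 1 := mem_ball_zero_iff.mp x.1.2
    have ht := hp01 x.2
    simp only [mem_ball_zero_iff, norm_mul, norm_real, Real.norm_of_nonneg ht.1]
    nlinarith [ht.1, ht.2, norm_nonneg (x.1 : ℂ)]
  rw [continuousOn_iff_continuous_domRestrict]
  have hcont : Continuous fun x : ball (0 : ℂ) 1 × ℝ =>
      g ((p x.2 : ℂ) * x.1) * (p x.2 : ℂ) ^ c :=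
    (hg.comp_continuous (by fun_prop) hmem).mul (by fun_prop)
  refine (intervalIntegral.continuous_parametric_intervalIntegral_of_continuous'
    (μ := MeasureTheory.volume)
    (f := fun (z : ball (0 : ℂ) 1) (t : ℝ) => g ((p t : ℂ) * z) * (p t : ℂ) ^ c)
    hcont 0 1).congr fun z => ?_
  refine intervalIntegral.integral_congr fun t ht => ?_
  rw [uIcc_of_le zero_le_one] at ht
  have : p t = t := by simp [p, projIcc_of_mem zero_le_one ht]
  simp only [this]

lemma bernardiIntegrand_eq_dslope {f : ℂ → ℂ} (hf0 : f 0 = 0) (c : ℕ) :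
    bernardiIntegrand c f = fun ζ => dslope f 0 ζ * ζ ^ c := by
  funext ζ
  by_cases h : ζ = 0
  · subst h
    simp [bernardiIntegrand]
  · simp [bernardiIntegrand, h, dslope_of_ne, slope_def_field, hf0]

lemma segIntegral_bernardiIntegrand {f : ℂ → ℂ} (hf0 : f 0 = 0) (c : ℕ) (z : ℂ) :
    segIntegral (bernardiIntegrand c f) z =
      z ^ (c + 1) * ∫ t in (0 : ℝ)..1, dslope f 0 ((t : ℂ) * z) * (t : ℂ) ^ c := by
  rw [segIntegral, bernardiIntegrand_eq_dslope hf0, pow_succ', mul_assoc,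
    ← intervalIntegral.integral_const_mul (z ^ c)]
  refine congrArg (z * ·) (intervalIntegral.integral_congr fun t _ => ?_)
  simp only [mul_pow]
  ring

/-- For `0 ≤ α < 1` and `c = 0, 1, 2, ⋯`, the Bernardi transform preserves
the class `S*(α)` of starlike functions of order `α`. -/
theorem bernardi_preserves_starlike_order (α : ℝ) (hα0 : 0 ≤ α) (hα1 : α < 1) (c : ℕ)
    (f : ℂ → ℂ) (hf : AnalyticOnNhd ℂ f (ball 0 1)) (hf0 : f 0 = 0) (hf1 : deriv f 0 = 1)
    (hstar : ∀ z ∈ ball (0 : ℂ) 1, z ≠ 0 → f z ≠ 0 ∧ α < (z * deriv f z / f z).re) :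
    ∀ z ∈ ball (0 : ℂ) 1, z ≠ 0 →
      bernardi c f z ≠ 0 ∧ α < (z * deriv (bernardi c f) z / bernardi c f z).re := by
  set g := dslope f 0 with hg
  set S := segIntegral (bernardiIntegrand c f) with hS
  have hgd : DifferentiableOn ℂ g (ball 0 1) :=
    (differentiableOn_dslope (ball_mem_nhds 0 one_pos)).mpr hf.differentiableOn
  have hg0 : g 0 = 1 := by rw [hg, dslope_same, hf1]
  have hgz : ∀ z : ℂ, z ≠ 0 → g z = f z / z := by
    intro z hz
    simp [hg, dslope_of_ne, hz, slope_def_field, hf0]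
  have hgne : ∀ z ∈ ball (0 : ℂ) 1, g z ≠ 0 := by
    intro z hz
    by_cases h : z = 0
    · simp [h, hg0]
    · rw [hgz z h]
      exact div_ne_zero (hstar z hz h).1 h
  have hSd : ∀ z ∈ ball (0 : ℂ) 1, z ≠ 0 → HasDerivAt S (f z / z * z ^ c) z := by
    intro z hz hz0
    have hG : DifferentiableOn ℂ (bernardiIntegrand c f) (ball 0 1) := by
      rw [bernardiIntegrand_eq_dslope hf0]
      exact hgd.mul (by fun_prop)
    have h := hasDerivAt_segIntegral_s14 hG hz
    simpa only [bernardiIntegrand, if_neg hz0] using h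
  have hpow : ∀ z : ℂ, HasDerivAt (fun w : ℂ => w ^ c) (c * z ^ (c - 1)) z :=
    fun z => hasDerivAt_pow c z
  have hpow_mul : ∀ z : ℂ, z * (c * z ^ (c - 1)) = c * z ^ c := by
    intro z
    cases c with
    | zero => simp
    | succ m => simp only [Nat.add_sub_cancel, pow_succ]; ring
  set u : ℂ → ℂ := fun z => (∫ t in (0 : ℝ)..1, g ((t : ℂ) * z) * (t : ℂ) ^ c) / g z with hu
  have hueq : ∀ z : ℂ, z ≠ 0 → u z = S z / (z ^ c * f z) := by
    intro z hz
    simp only [hu, hS, segIntegral_bernardiIntegrand hf0, ← hg, hgz z hz, pow_succ]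
    generalize ∫ t in (0 : ℝ)..1, g ((t : ℂ) * z) * (t : ℂ) ^ c = J
    field_simp
  have hcont : ContinuousOn u (ball 0 1) :=
    (continuousOn_integral_radius hgd.continuousOn c).div hgd.continuousOn hgne
  have hu0 : u 0 = ((1 / (c + 1) : ℝ) : ℂ) := by
    have : ∫ t in (0 : ℝ)..1, (t : ℂ) ^ c = ((∫ t in (0 : ℝ)..1, t ^ c : ℝ) : ℂ) := by
      rw [← intervalIntegral.integral_ofReal]
      simp
    simp only [hu, mul_zero, hg0, one_mul, div_one, this, integral_pow]
    simp
  have hud : ∀ z ∈ ball (0 : ℂ) 1, z ≠ 0 → HasDerivAt u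
      ((f z / z * z ^ c * (z ^ c * f z) -
        S z * (c * z ^ (c - 1) * f z + z ^ c * deriv f z)) / (z ^ c * f z) ^ 2) z := by
    intro z hz hz0
    refine ((hSd z hz hz0).fun_div
      ((hpow z).fun_mul (hf z hz).differentiableAt.hasDerivAt)
      (mul_ne_zero (pow_ne_zero c hz0) (hstar z hz hz0).1)).congr_of_eventuallyEq ?_
    filter_upwards [isOpen_ne.mem_nhds hz0] with w hw using hueq w hw
  have hmain := mul_normSq_lt_re_of_ode (β := α + c) (by positivity)
    (Q := fun z => c + z * deriv f z / f z) hcont hud (by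
      intro z hz hz0
      have hfz := (hstar z hz hz0).1
      have hzc := pow_ne_zero c hz0
      rw [hueq z hz0]
      field_simp
      linear_combination (-S z * f z) * hpow_mul z) (by
      intro z hz hz0
      have := (hstar z hz hz0).2
      simp only [add_re, natCast_re]
      linarith) (by
      rw [hu0, normSq_ofReal, ofReal_re]
      field_simp
      linarith)
  intro z hz hz0
  have hfz := (hstar z hz hz0).1
  have hzc := pow_ne_zero c hz0
  have huz := hmain z hz
  have hune : u z ≠ 0 := by
    intro h
    simp [h] at huz
  have hSz : S z ≠ 0 := by
    intro h
    exact hune (by rw [hueq z hz0, h, zero_div])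
  have hcC : (1 + c : ℂ) ≠ 0 := by
    rw [add_comm]
    exact Nat.cast_add_one_ne_zero c
  have hB : bernardi c f z = (1 + c : ℂ) / z ^ c * S z := by simp [bernardi, hz0, hS]
  have hBd : HasDerivAt (bernardi c f)
      ((0 * z ^ c - (1 + c : ℂ) * (c * z ^ (c - 1))) / (z ^ c) ^ 2 * S z +
        (1 + c : ℂ) / z ^ c * (f z / z * z ^ c)) z := by
    refine (((hasDerivAt_const z (1 + c : ℂ)).fun_div (hpow z) hzc).fun_mul
      (hSd z hz hz0)).congr_of_eventuallyEq ?_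
    filter_upwards [isOpen_ne.mem_nhds hz0] with w hw
    have hw' : w ≠ 0 := hw
    simp [bernardi, hw', hS]
  refine ⟨by rw [hB]; exact mul_ne_zero (div_ne_zero hcC hzc) hSz, ?_⟩
  have hquot : z * deriv (bernardi c f) z / bernardi c f z = (u z)⁻¹ - c := by
    rw [hBd.deriv, hB, hueq z hz0]
    field_simp
    linear_combination (-S z * (1 + c)) * hpow_mul z
  have hpos : 0 < normSq (u z) := normSq_pos.mpr hune
  rw [hquot, sub_re, inv_re, natCast_re, lt_sub_iff_add_lt, lt_div_iff₀ hpos]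
  exact huz
end

section
/- Let −1 ≤ B < A ≤ 1 be real numbers with Re((1+Az)/(1+Bz)) > 0 for all z ∈ 𝔻, let Ψ(z) = (1+Az)/(1+Bz), and let c ≥ 0 be an integer. If f is a normalized analytic function on 𝔻 in the Janowski class S*[A,B], i.e., f(z) ≠ 0 and z·f'(z)/f(z) ∈ Ψ(𝔻) for all z ∈ 𝔻 \ {0} (z f'/f ≺ (1+Az)/(1+Bz)), then its Bernardi transform F = B_c(f) satisfies F(z) ≠ 0 and z·F'(z)/F(z) ∈ Ψ(𝔻) for all z ∈ 𝔻 \ {0}. Hence B_c(S*[A,B]) ⊆ S*[A,B]. -/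
open Complex Metric Set

open Filter Topology ComplexConjugate

/-- The Hermitian form `|P - G|² - |A G - B P|²`. For `G ≠ 0` it is negative exactly when `P / G`
lies in the image of the unit disk under `w ↦ (1 + A w) / (1 + B w)`. -/
noncomputable def janowskiForm (A B : ℝ) (P G : ℂ) : ℝ :=
  normSq (P - G) - normSq (A * G - B * P)

lemma janowskiForm_mul (A B : ℝ) (P G w : ℂ) :
    janowskiForm A B (P * w) (G * w) = janowskiForm A B P G * normSq w := by
  simp only [janowskiForm, normSq_apply, sub_re, sub_im, mul_re, mul_im, ofReal_re, ofReal_im]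
  ring

lemma janowskiForm_div (A B : ℝ) (P : ℂ) {G : ℂ} (hG : G ≠ 0) :
    janowskiForm A B (P / G) 1 * normSq G = janowskiForm A B P G := by
  rw [← janowskiForm_mul, div_mul_cancel₀ _ hG, one_mul]

lemma janowskiForm_div_neg_iff {A B : ℝ} {P G : ℂ} (hG : G ≠ 0) :
    janowskiForm A B (P / G) 1 < 0 ↔ janowskiForm A B P G < 0 := by
  rw [← janowskiForm_div A B P hG]
  exact ⟨(mul_neg_of_neg_of_pos · (normSq_pos.2 hG)), (neg_of_mul_neg_left · (normSq_nonneg G))⟩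

lemma ne_zero_of_janowskiForm_neg {A B : ℝ} (hB : B ^ 2 ≤ 1) {P G : ℂ}
    (h : janowskiForm A B P G < 0) : G ≠ 0 := by
  rintro rfl
  simp only [janowskiForm, normSq_apply, sub_re, sub_im, mul_re, mul_im, ofReal_re, ofReal_im,
    zero_re, zero_im] at h
  nlinarith [mul_nonneg (sub_nonneg.2 hB) (add_nonneg (sq_nonneg P.re) (sq_nonneg P.im))]

lemma one_add_mul_ne_zero {B : ℝ} (hB : B ^ 2 ≤ 1) {w : ℂ} (hw : w ∈ ball (0 : ℂ) 1) :
    1 + (B : ℂ) * w ≠ 0 := by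
  intro h
  have h1 : ‖(B : ℂ) * w‖ = 1 := by
    rw [eq_neg_of_add_eq_zero_right h, norm_neg, norm_one]
  rw [norm_mul, norm_real, Real.norm_eq_abs] at h1
  have h2 : |B| ≤ 1 := by rwa [← sq_le_one_iff_abs_le_one]
  have h3 : ‖w‖ < 1 := mem_ball_zero_iff.1 hw
  nlinarith [norm_nonneg w, abs_nonneg B]

lemma mem_image_iff_janowskiForm_neg {A B : ℝ} (hB : B ^ 2 ≤ 1) (hBA : B < A) (p : ℂ) :
    p ∈ (fun w : ℂ => (1 + (A : ℂ) * w) / (1 + (B : ℂ) * w)) '' ball 0 1 ↔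
      janowskiForm A B p 1 < 0 := by
  have hAB : (A : ℂ) - B ≠ 0 := sub_ne_zero.2 (by exact_mod_cast hBA.ne')
  constructor
  · rintro ⟨w, hw, rfl⟩
    have hD := one_add_mul_ne_zero hB hw
    have hw1 : normSq w < 1 := by
      rw [normSq_eq_norm_sq]
      have := mem_ball_zero_iff.1 hw
      nlinarith [norm_nonneg w]
    have key : janowskiForm A B (1 + A * w) (1 + B * w) = (A - B) ^ 2 * (normSq w - 1) := by
      simp only [janowskiForm, normSq_apply, sub_re, sub_im, add_re, add_im, mul_re, mul_im,
        ofReal_re, ofReal_im, one_re, one_im]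
      ring
    have h := janowskiForm_div A B (1 + A * w) hD
    rw [key] at h
    have : 0 < normSq (1 + B * w) := normSq_pos.2 hD
    have : 0 < (A - B) ^ 2 := by have := sub_pos.2 hBA; positivity
    by_contra! hn
    have hn := mul_nonneg hn (normSq_nonneg (1 + B * w))
    beta_reduce at hn
    nlinarith
  · intro h
    have hlt : normSq (p - 1) < normSq (A - B * p) := by
      simpa [janowskiForm] using h
    have hD : (A : ℂ) - B * p ≠ 0 := normSq_pos.1 ((normSq_nonneg _).trans_lt hlt)
    refine ⟨(p - 1) / (A - B * p), ?_, ?_⟩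
    · rw [mem_ball_zero_iff, norm_div, div_lt_one (norm_pos_iff.2 hD)]
      rw [normSq_eq_norm_sq, normSq_eq_norm_sq] at hlt
      exact lt_of_pow_lt_pow_left₀ 2 (norm_nonneg _) hlt
    · have h1 : 1 + (A : ℂ) * ((p - 1) / (A - B * p)) = p * (A - B) / (A - B * p) := by
        rw [eq_div_iff hD, add_mul, mul_assoc, div_mul_cancel₀ _ hD]; ring
      have h2 : 1 + (B : ℂ) * ((p - 1) / (A - B * p)) = (A - B) / (A - B * p) := by
        rw [eq_div_iff hD, add_mul, mul_assoc, div_mul_cancel₀ _ hD]; ring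
      beta_reduce
      rw [h1, h2, div_div_div_cancel_right₀ hD, mul_div_cancel_right₀ _ hAB]

/-- Half the gradient of `p ↦ janowskiForm A B p 1`, conjugated. -/
noncomputable def janowskiGrad (A B : ℝ) (p : ℂ) : ℂ :=
  (1 - B ^ 2) * conj p - (1 - A * B)

lemma janowskiForm_add (A B : ℝ) (p v : ℂ) :
    janowskiForm A B (p + v) 1 = janowskiForm A B p 1 + 2 * (janowskiGrad A B p * v).re +
      (1 - B ^ 2) * normSq v := by
  have : ((1 : ℂ) - (B : ℂ) ^ 2) = ((1 - B ^ 2 : ℝ) : ℂ) := by push_cast; rfl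
  have h2 : ((1 : ℂ) - (A : ℂ) * B) = ((1 - A * B : ℝ) : ℂ) := by push_cast; rfl
  simp only [janowskiForm, janowskiGrad, this, h2, normSq_apply, sub_re, sub_im, add_re, add_im,
    mul_re, mul_im, ofReal_re, ofReal_im, one_re, one_im, conj_re, conj_im]
  ring

lemma HasDerivAt.janowskiForm {A B : ℝ} {u : ℝ → ℂ} {u' : ℂ} {t : ℝ} (hu : HasDerivAt u u' t) :
    HasDerivAt (fun s => janowskiForm A B (u s) 1)
      (2 * (janowskiGrad A B (u t) * u').re) t := by
  have hre : HasDerivAt (fun s => (u s).re) u'.re t :=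
    reCLM.hasFDerivAt.comp_hasDerivAt t hu
  have him : HasDerivAt (fun s => (u s).im) u'.im t :=
    imCLM.hasFDerivAt.comp_hasDerivAt t hu
  have h : (fun s => _root_.janowskiForm A B (u s) 1) = fun s =>
      (1 - B ^ 2) * ((u s).re ^ 2 + (u s).im ^ 2) - 2 * (1 - A * B) * (u s).re + (1 - A ^ 2) := by
    funext s
    simp only [_root_.janowskiForm, normSq_apply, sub_re, sub_im, mul_re, mul_im, ofReal_re,
      ofReal_im, one_re, one_im]
    ring
  rw [h]
  have this : ((1 : ℂ) - (B : ℂ) ^ 2) = ((1 - B ^ 2 : ℝ) : ℂ) := by push_cast; rfl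
  have h2 : ((1 : ℂ) - (A : ℂ) * B) = ((1 - A * B : ℝ) : ℂ) := by push_cast; rfl
  refine HasDerivAt.congr_deriv (((((hre.pow 2).add (him.pow 2)).const_mul (1 - B ^ 2)).sub
    (hre.const_mul (2 * (1 - A * B)))).add_const (1 - A ^ 2)) ?_
  simp only [janowskiGrad, this, h2, sub_re, sub_im, mul_re, mul_im, ofReal_re, ofReal_im,
    conj_re, conj_im]
  ring

lemma eventually_norm_mul_one_add_lt {z₀ v : ℂ} (hz₀ : z₀ ≠ 0) (hv : v.re < 0) :
    ∀ᶠ t : ℝ in 𝓝[>] 0, ‖z₀ * (1 + t * v)‖ < ‖z₀‖ := by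
  have hlim : Tendsto (fun t : ℝ => 2 * v.re + t * normSq v) (𝓝[>] 0) (𝓝 (2 * v.re)) := by
    have : Continuous fun t : ℝ => 2 * v.re + t * normSq v := by fun_prop
    simpa using (this.tendsto 0).mono_left nhdsWithin_le_nhds
  filter_upwards [hlim.eventually_lt_const (by linarith : 2 * v.re < 0), self_mem_nhdsWithin]
    with t ht ht0
  have ht0 : 0 < t := ht0
  have h : ‖1 + t * v‖ ^ 2 < 1 ^ 2 := by
    rw [← normSq_eq_norm_sq]
    have : normSq (1 + t * v) = 1 + t * (2 * v.re + t * normSq v) := by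
      simp [normSq_apply]; ring
    nlinarith
  have := lt_of_pow_lt_pow_left₀ 2 zero_le_one h
  rw [norm_mul]
  nlinarith [norm_pos_iff.2 hz₀]

lemma re_janowskiGrad_mul_nonpos {A B : ℝ} {p : ℂ → ℂ} {p' z₀ v : ℂ} (hz₀ : z₀ ≠ 0)
    (hp : HasDerivAt p p' z₀) (hin : ∀ z, ‖z‖ < ‖z₀‖ → janowskiForm A B (p z) 1 < 0)
    (hbd : 0 ≤ janowskiForm A B (p z₀) 1) (hv : v.re < 0) :
    (janowskiGrad A B (p z₀) * (z₀ * p' * v)).re ≤ 0 := by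
  have hγ : HasDerivAt (fun t : ℝ => z₀ * (1 + t * v)) (z₀ * v) 0 := by
    simpa using ((ofRealCLM.hasDerivAt.mul_const v).const_add 1).const_mul z₀
  have hu : HasDerivAt (fun t : ℝ => p (z₀ * (1 + t * v))) (z₀ * p' * v) 0 := by
    have hp1 : HasDerivAt p p' ((fun t : ℝ => z₀ * (1 + t * v)) 0) := by simpa using hp
    refine (hp1.comp 0 hγ).congr_deriv ?_
    ring
  have hφ := hu.janowskiForm (A := A) (B := B)
  have hs := (hasDerivAt_iff_tendsto_slope.1 hφ).mono_left
    (nhdsWithin_mono (0 : ℝ) (fun t (ht : t ∈ Ioi (0 : ℝ)) => (ne_of_gt ht : t ≠ 0)))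
  have hle := le_of_tendsto hs (b := 0) (by
    filter_upwards [eventually_norm_mul_one_add_lt hz₀ hv, self_mem_nhdsWithin] with t ht ht0
    have ht0 : 0 < t := ht0
    have h1 := hin _ ht
    rw [slope_def_field]
    refine div_nonpos_of_nonpos_of_nonneg ?_ (by linarith)
    simp only [ofReal_zero, zero_mul, add_zero, mul_one]
    linarith)
  simp only [ofReal_zero, zero_mul, add_zero, mul_one] at hle
  linarith

/-- At a first exit point `z₀`, moving from `p z₀` by `z₀ p'(z₀)` times a number with nonnegative
real part does not lead back into the region. -/
lemma janowskiForm_add_mul_nonneg {A B : ℝ} (hB : B ^ 2 ≤ 1) {p : ℂ → ℂ} {p' z₀ m : ℂ}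
    (hz₀ : z₀ ≠ 0) (hp : HasDerivAt p p' z₀)
    (hin : ∀ z, ‖z‖ < ‖z₀‖ → janowskiForm A B (p z) 1 < 0)
    (hbd : 0 ≤ janowskiForm A B (p z₀) 1) (hm : 0 ≤ m.re) :
    0 ≤ janowskiForm A B (p z₀ + z₀ * p' * m) 1 := by
  have h : 0 ≤ (janowskiGrad A B (p z₀) * (z₀ * p' * m)).re := by
    have hc : Continuous fun ε : ℝ => (janowskiGrad A B (p z₀) * (z₀ * p' * (m + ε))).re := by
      fun_prop
    have hlim := (hc.tendsto 0).mono_left (nhdsWithin_le_nhds (s := Ioi 0))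
    simp only [ofReal_zero, add_zero] at hlim
    refine ge_of_tendsto hlim ?_
    filter_upwards [self_mem_nhdsWithin] with ε hε
    have hε : 0 < ε := hε
    have := re_janowskiGrad_mul_nonpos (v := -(m + ε)) hz₀ hp hin hbd
      (by simp only [neg_re, add_re, ofReal_re]; linarith)
    simpa only [mul_neg, neg_re, neg_nonpos] using this
  rw [janowskiForm_add]
  have := mul_nonneg (sub_nonneg.2 hB) (normSq_nonneg (z₀ * p' * m))
  linarith

lemma ofReal_mul_mem_ball {t : ℝ} (ht : t ∈ Icc (0 : ℝ) 1) {z : ℂ} {r : ℝ}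
    (hz : z ∈ ball (0 : ℂ) r) : (t : ℂ) * z ∈ ball (0 : ℂ) r := by
  rw [mem_ball_zero_iff] at *
  rw [norm_mul, norm_real, Real.norm_of_nonneg ht.1]
  exact (mul_le_of_le_one_left (norm_nonneg z) ht.2).trans_lt hz

lemma ContinuousOn.comp_ofReal_mul {g : ℂ → ℂ} (hg : ContinuousOn g (ball 0 1)) {z : ℂ}
    (hz : z ∈ ball (0 : ℂ) 1) :
    ContinuousOn (fun t : ℝ => g (t * z)) (uIcc 0 1) := by
  rw [uIcc_of_le zero_le_one]
  exact hg.comp (by fun_prop) fun t ht => ofReal_mul_mem_ball ht hz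

lemma hasDerivAt_integral_pow_mul_comp_mul {g : ℂ → ℂ} (hg : DifferentiableOn ℂ g (ball 0 1))
    (c : ℕ) {z : ℂ} (hz : z ∈ ball (0 : ℂ) 1) :
    HasDerivAt (fun w => ∫ t in (0 : ℝ)..1, (t : ℂ) ^ c * g (t * w))
      (∫ t in (0 : ℝ)..1, (t : ℂ) ^ c * (t * deriv g (t * z))) z := by
  have hg' : ContinuousOn (deriv g) (ball 0 1) := (hg.deriv isOpen_ball).continuousOn
  obtain ⟨r, hzr, hr1⟩ := exists_between (mem_ball_zero_iff.1 hz)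
  obtain ⟨C, hC⟩ := (isCompact_closedBall (0 : ℂ) r).exists_bound_of_continuousOn
    (hg'.mono (closedBall_subset_ball hr1))
  have hF (w : ℂ) (hw : w ∈ ball (0 : ℂ) 1) :
      IntervalIntegrable (fun t : ℝ => (t : ℂ) ^ c * g (t * w)) MeasureTheory.volume 0 1 :=
    ((by fun_prop : ContinuousOn (fun t : ℝ => (t : ℂ) ^ c) _).mul
      (hg.continuousOn.comp_ofReal_mul hw)).intervalIntegrable
  have hF' : IntervalIntegrable (fun t : ℝ => (t : ℂ) ^ c * (t * deriv g (t * z)))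
      MeasureTheory.volume 0 1 :=
    ((by fun_prop : ContinuousOn (fun t : ℝ => (t : ℂ) ^ c) _).mul
      ((by fun_prop : ContinuousOn (fun t : ℝ => (t : ℂ)) _).mul
      (hg'.comp_ofReal_mul hz))).intervalIntegrable
  refine (intervalIntegral.hasDerivAt_integral_of_dominated_loc_of_deriv_le
    (F' := fun w t => (t : ℂ) ^ c * (t * deriv g (t * w))) (bound := fun _ => C)
    (isOpen_ball.mem_nhds (mem_ball_zero_iff.2 hzr)) ?_ (hF z hz)
    hF'.def'.aestronglyMeasurable ?_ intervalIntegrable_const ?_).2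
  · filter_upwards [isOpen_ball.mem_nhds hz] with w hw
    exact (hF w hw).def'.aestronglyMeasurable
  · refine .of_forall fun t ht w hw => ?_
    rw [uIoc_of_le zero_le_one] at ht
    have h := hC _ (ball_subset_closedBall (ofReal_mul_mem_ball ⟨ht.1.le, ht.2⟩ hw))
    rw [norm_mul, norm_mul, norm_pow, norm_real, Real.norm_of_nonneg ht.1.le, ← mul_assoc,
      ← pow_succ]
    exact (mul_le_of_le_one_left (norm_nonneg _) (pow_le_one₀ ht.1.le ht.2)).trans h
  · refine .of_forall fun t ht w hw => ?_
    rw [uIoc_of_le zero_le_one] at ht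
    have hmem := ofReal_mul_mem_ball ⟨ht.1.le, ht.2⟩ (ball_subset_ball hr1.le hw)
    have h := (hg.differentiableAt (isOpen_ball.mem_nhds hmem)).hasDerivAt.comp w
      ((hasDerivAt_id w).const_mul (t : ℂ))
    refine (h.const_mul ((t : ℂ) ^ c)).congr_deriv ?_
    ring

lemma succ_mul_integral_add_mul_integral_deriv {g : ℂ → ℂ}
    (hg : DifferentiableOn ℂ g (ball 0 1)) (c : ℕ) {z : ℂ} (hz : z ∈ ball (0 : ℂ) 1) :
    (1 + c : ℂ) * (∫ t in (0 : ℝ)..1, (t : ℂ) ^ c * g (t * z)) +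
      z * (∫ t in (0 : ℝ)..1, (t : ℂ) ^ c * (t * deriv g (t * z))) = g z := by
  have hg' : ContinuousOn (deriv g) (ball 0 1) := (hg.deriv isOpen_ball).continuousOn
  have h1 : ContinuousOn (fun t : ℝ => (t : ℂ) ^ c * g (t * z)) (uIcc 0 1) :=
    (by fun_prop : ContinuousOn (fun t : ℝ => (t : ℂ) ^ c) _).mul
      (hg.continuousOn.comp_ofReal_mul hz)
  have h2 : ContinuousOn (fun t : ℝ => (t : ℂ) ^ c * (t * deriv g (t * z))) (uIcc 0 1) :=
    (by fun_prop : ContinuousOn (fun t : ℝ => (t : ℂ) ^ c) _).mul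
      ((by fun_prop : ContinuousOn (fun t : ℝ => (t : ℂ)) _).mul (hg'.comp_ofReal_mul hz))
  have h3 := (h1.intervalIntegrable (μ := MeasureTheory.volume)).const_mul (1 + c : ℂ)
  have h4 := (h2.intervalIntegrable (μ := MeasureTheory.volume)).const_mul z
  rw [← intervalIntegral.integral_const_mul, ← intervalIntegral.integral_const_mul,
    ← intervalIntegral.integral_add h3 h4,
    intervalIntegral.integral_eq_sub_of_hasDerivAt
      (f := fun t : ℝ => (t : ℂ) ^ (c + 1) * g (t * z)) _ (h3.add h4)]
  · simp
  · intro t ht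
    rw [uIcc_of_le zero_le_one] at ht
    have hd := (hg.differentiableAt (isOpen_ball.mem_nhds (ofReal_mul_mem_ball ht hz))).hasDerivAt
    have ht1 : HasDerivAt (fun s : ℝ => (s : ℂ)) 1 t := ofRealCLM.hasDerivAt
    refine ((ht1.pow (c + 1)).mul (hd.comp t (ht1.mul_const z))).congr_deriv ?_
    simp only [Function.comp_apply, Pi.pow_apply]
    push_cast
    ring

lemma ne_zero_of_re_nonneg_on_ray {G : ℂ → ℂ} (hG : DifferentiableOn ℂ G (ball 0 1)) {z : ℂ}
    (hz : z ∈ ball (0 : ℂ) 1)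
    (hre : ∀ t ∈ Ioo (0 : ℝ) 1,
      0 ≤ (conj (G (t * z)) * (G (t * z) + t * z * deriv G (t * z))).re)
    {s : ℝ} (hs : s ∈ Ioo (0 : ℝ) 1) (hGs : G (s * z) ≠ 0) : G z ≠ 0 := by
  have hd (t : ℝ) (ht : t ∈ Icc (0 : ℝ) 1) : HasDerivAt (fun t : ℝ => ‖t * G (t * z)‖ ^ 2)
      (2 * (conj (t * G (t * z)) * (G (t * z) + t * (deriv G (t * z) * z))).re) t := by
    have hGd :=
      (hG.differentiableAt (isOpen_ball.mem_nhds (ofReal_mul_mem_ball ht hz))).hasDerivAt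
    have ht1 : HasDerivAt (fun s : ℝ => (s : ℂ)) 1 t := ofRealCLM.hasDerivAt
    refine ((ht1.mul (hGd.comp t (ht1.mul_const z))).norm_sq).congr_deriv ?_
    simp [Complex.inner, mul_comm]
  have hmono : MonotoneOn (fun t : ℝ => ‖t * G (t * z)‖ ^ 2) (Icc 0 1) := by
    refine monotoneOn_of_deriv_nonneg (convex_Icc 0 1)
      (fun t ht => (hd t ht).continuousAt.continuousWithinAt)
      (fun t ht => (hd t (interior_subset ht)).differentiableAt.differentiableWithinAt) ?_
    intro t ht
    rw [(hd t (interior_subset ht)).deriv]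
    rw [interior_Icc] at ht
    have h := mul_nonneg ht.1.le (hre t ht)
    have e : conj ((t : ℂ) * G (t * z)) * (G (t * z) + t * (deriv G (t * z) * z)) =
        t * (conj (G (t * z)) * (G (t * z) + t * z * deriv G (t * z))) := by
      rw [map_mul, conj_ofReal]; ring
    rw [e, re_ofReal_mul]
    linarith
  have hle := hmono ⟨hs.1.le, hs.2.le⟩ (right_mem_Icc.2 zero_le_one) hs.2.le
  have hpos : 0 < ‖s * G (s * z)‖ ^ 2 :=
    pow_pos (norm_pos_iff.2 (mul_ne_zero (ofReal_ne_zero.2 hs.1.ne') hGs)) 2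
  intro h0
  simp only [ofReal_one, one_mul, h0, norm_zero, ne_eq, OfNat.ofNat_ne_zero, not_false_eq_true,
    zero_pow] at hle
  linarith

/-- A first point, in modulus, where a continuous function on the disk fails to be negative. -/
lemma exists_min_norm_nonneg {h : ℂ → ℝ} (hc : ContinuousOn h (ball 0 1)) {z₁ : ℂ}
    (hz₁ : z₁ ∈ ball (0 : ℂ) 1) (hh : 0 ≤ h z₁) :
    ∃ z₀ ∈ ball (0 : ℂ) 1, 0 ≤ h z₀ ∧ ∀ z, ‖z‖ < ‖z₀‖ → h z < 0 := by
  have hsub : closedBall (0 : ℂ) ‖z₁‖ ⊆ ball 0 1 :=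
    closedBall_subset_ball (mem_ball_zero_iff.1 hz₁)
  have hK : IsCompact (closedBall (0 : ℂ) ‖z₁‖ ∩ h ⁻¹' Ici 0) :=
    (isCompact_closedBall _ _).of_isClosed_subset
      ((hc.mono hsub).preimage_isClosed_of_isClosed isClosed_closedBall isClosed_Ici)
      inter_subset_left
  obtain ⟨z₀, hz₀, hmin⟩ := hK.exists_isMinOn ⟨z₁, by simp, hh⟩ continuous_norm.continuousOn
  refine ⟨z₀, hsub hz₀.1, hz₀.2, fun z hz => ?_⟩
  by_contra! hn
  refine hz.not_ge (hmin ⟨?_, hn⟩)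
  exact mem_closedBall_zero_iff.2 (hz.le.trans (mem_closedBall_zero_iff.1 hz₀.1))

lemma janowskiForm_self (A B : ℝ) (P : ℂ) :
    janowskiForm A B P P = -((A - B) ^ 2 * normSq P) := by
  simp only [janowskiForm, normSq_apply, sub_re, sub_im, mul_re, mul_im, ofReal_re, ofReal_im]
  ring

lemma ContinuousOn.janowskiForm {A B : ℝ} {P G : ℂ → ℂ} {s : Set ℂ} (hP : ContinuousOn P s)
    (hG : ContinuousOn G s) : ContinuousOn (fun z => janowskiForm A B (P z) (G z)) s := by
  have h1 := continuous_normSq.comp_continuousOn (hP.sub hG)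
  have h2 := continuous_normSq.comp_continuousOn
    ((continuousOn_const (c := (A : ℂ))).mul hG |>.sub ((continuousOn_const (c := (B : ℂ))).mul hP))
  exact h1.sub h2

lemma re_nonneg_of_re_pos_on_ray {p : ℂ → ℂ} {z : ℂ} (hp : ContinuousAt p z)
    (h : ∀ t ∈ Ioo (0 : ℝ) 1, 0 < (p (t * z)).re) : 0 ≤ (p z).re := by
  have hc : ContinuousAt (fun t : ℝ => (p (t * z)).re) 1 := by
    refine continuous_re.continuousAt.comp (ContinuousAt.comp (g := p) ?_ (by fun_prop))
    simpa using hp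
  have hlim := hc.tendsto.mono_left (nhdsWithin_le_nhds (s := Iio 1))
  simp only [ofReal_one, one_mul] at hlim
  refine ge_of_tendsto hlim ?_
  filter_upwards [Ioo_mem_nhdsLT zero_lt_one] with t ht using (h t ht).le

lemma briot_bouquet_identity {k z G D E g g' : ℂ} (hk : k ≠ 0) (hG : G ≠ 0) (hg : g ≠ 0)
    (hode : k * g = k * G + z * D) (hg' : k * g' = k * D + (D + z * E)) :
    (g + z * g') / g = (G + z * D) / G +
      z * (((D + (D + z * E)) * G - (G + z * D) * D) / G ^ 2) * (k * g / G)⁻¹ := by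
  rw [inv_div, div_eq_iff hg]
  field_simp
  linear_combination (-(z * D)) * hode + z * G * hg'

/-- Briot–Bouquet subordination: if `(1 + c) g = (1 + c) G + z G'` and `1 + z g' / g` takes values
in a Janowski region contained in the right half-plane, then so does `1 + z G' / G`. -/
theorem janowskiForm_neg_of_briot_bouquet {A B : ℝ} (hB : B ^ 2 ≤ 1) (hBA : B < A)
    (hre : ∀ p, janowskiForm A B p 1 < 0 → 0 < p.re) {c : ℝ} (hc : 0 ≤ c) {g G : ℂ → ℂ}
    (hg0 : g 0 ≠ 0) (hG : DifferentiableOn ℂ G (ball 0 1))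
    (hode : ∀ z ∈ ball (0 : ℂ) 1, (1 + c : ℂ) * g z = (1 + c) * G z + z * deriv G z)
    (hg : ∀ z ∈ ball (0 : ℂ) 1, janowskiForm A B (g z + z * deriv g z) (g z) < 0) :
    ∀ z ∈ ball (0 : ℂ) 1, janowskiForm A B (G z + z * deriv G z) (G z) < 0 := by
  have hc1 : (1 + c : ℂ) ≠ 0 := by exact_mod_cast (by linarith : (1 + c : ℝ) ≠ 0)
  have hG' : DifferentiableOn ℂ (deriv G) (ball 0 1) := hG.deriv isOpen_ball
  intro z₁ hz₁
  by_contra! hneg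
  have hcont : ContinuousOn (fun z => janowskiForm A B (G z + z * deriv G z) (G z)) (ball 0 1) :=
    (hG.continuousOn.add (continuousOn_id.mul hG'.continuousOn)).janowskiForm hG.continuousOn
  obtain ⟨z₀, hz₀, hbd, hin⟩ := exists_min_norm_nonneg hcont hz₁ hneg
  have hne : z₀ ≠ 0 := by
    rintro rfl
    have h0 : G 0 = g 0 := by
      have := hode 0 hz₀
      rw [zero_mul, add_zero] at this
      exact (mul_left_cancel₀ hc1 this).symm
    rw [zero_mul, add_zero, h0, janowskiForm_self] at hbd
    have : 0 < (A - B) ^ 2 * normSq (g 0) :=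
      mul_pos (pow_pos (sub_pos.2 hBA) 2) (normSq_pos.2 hg0)
    linarith
  set p : ℂ → ℂ := fun z => (G z + z * deriv G z) / G z with hp
  have hray (t : ℝ) (ht : t ∈ Ioo (0 : ℝ) 1) : ‖(t : ℂ) * z₀‖ < ‖z₀‖ := by
    rw [norm_mul, norm_real, Real.norm_of_nonneg ht.1.le]
    exact mul_lt_of_lt_one_left (norm_pos_iff.2 hne) ht.2
  have hGin (z : ℂ) (hz : ‖z‖ < ‖z₀‖) : G z ≠ 0 := ne_zero_of_janowskiForm_neg hB (hin z hz)
  have hpin (z : ℂ) (hz : ‖z‖ < ‖z₀‖) : janowskiForm A B (p z) 1 < 0 :=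
    (janowskiForm_div_neg_iff (hGin z hz)).2 (hin z hz)
  have hG0 : G z₀ ≠ 0 := by
    have hhalf : (1 / 2 : ℝ) ∈ Ioo (0 : ℝ) 1 := by norm_num
    refine ne_zero_of_re_nonneg_on_ray hG hz₀ (fun t ht => ?_) (s := 1 / 2) hhalf
      (hGin _ (hray _ hhalf))
    have hGt := hGin _ (hray t ht)
    have h := hre _ (hpin _ (hray t ht))
    have e : conj (G (t * z₀)) * (G (t * z₀) + t * z₀ * deriv G (t * z₀)) =
        (normSq (G (t * z₀)) : ℝ) * p (t * z₀) := by
      rw [normSq_eq_conj_mul_self, hp]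
      field_simp
    rw [e, re_ofReal_mul]
    exact mul_nonneg (normSq_nonneg _) h.le
  have hnhds : ball (0 : ℂ) 1 ∈ 𝓝 z₀ := isOpen_ball.mem_nhds hz₀
  have hdG := (hG.differentiableAt hnhds).hasDerivAt
  have hdG' := (hG'.differentiableAt hnhds).hasDerivAt
  have hzG' : HasDerivAt (fun z => z * deriv G z)
      (deriv G z₀ + z₀ * deriv (deriv G) z₀) z₀ := by
    simpa using (hasDerivAt_id' z₀).fun_mul hdG'
  have hdp : HasDerivAt p (((deriv G z₀ + (deriv G z₀ + z₀ * deriv (deriv G) z₀)) * G z₀ -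
      (G z₀ + z₀ * deriv G z₀) * deriv G z₀) / G z₀ ^ 2) z₀ :=
    (hdG.fun_add hzG').fun_div hdG hG0
  have hdg : (1 + c) * deriv g z₀ =
      (1 + c) * deriv G z₀ + (deriv G z₀ + z₀ * deriv (deriv G) z₀) := by
    have hev : (fun z => (1 + c : ℂ) * g z) =ᶠ[𝓝 z₀] fun z => (1 + c) * G z + z * deriv G z := by
      filter_upwards [hnhds] with z hz using hode z hz
    rw [← deriv_const_mul_field, hev.deriv_eq]
    exact ((hdG.const_mul (1 + c : ℂ)).fun_add hzG').deriv
  have hpre : 0 ≤ (p z₀).re :=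
    re_nonneg_of_re_pos_on_ray hdp.continuousAt fun t ht => hre _ (hpin _ (hray t ht))
  have hm : 0 ≤ ((p z₀ + c)⁻¹).re := by
    rw [inv_re, add_re, ofReal_re]
    exact div_nonneg (by linarith) (normSq_nonneg _)
  have hbd' : 0 ≤ janowskiForm A B (p z₀) 1 :=
    not_lt.1 fun h => hbd.not_gt ((janowskiForm_div_neg_iff hG0).1 h)
  have hkey := janowskiForm_add_mul_nonneg hB hne hdp hpin hbd' hm
  have hgz := hg z₀ hz₀
  have hg0' : g z₀ ≠ 0 := ne_zero_of_janowskiForm_neg hB hgz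
  have hpc : p z₀ + c = (1 + c) * g z₀ / G z₀ := by
    rw [hode z₀ hz₀, hp]
    field_simp
    ring
  rw [hpc] at hkey
  rw [hp, ← briot_bouquet_identity hc1 hG0 hg0' (hode z₀ hz₀) hdg] at hkey
  exact hkey.not_gt ((janowskiForm_div_neg_iff hg0').2 hgz)

lemma bernardi_eq {f : ℂ → ℂ} (hf0 : f 0 = 0) (c : ℕ) (z : ℂ) :
    bernardi c f z =
      z * ((1 + c) * ∫ t in (0 : ℝ)..1, (t : ℂ) ^ c * dslope f 0 (t * z)) := by
  rcases eq_or_ne z 0 with rfl | hz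
  · simp [bernardi]
  have hint : bernardiIntegrand c f = fun ζ => dslope f 0 ζ * ζ ^ c := by
    funext ζ
    rcases eq_or_ne ζ 0 with rfl | hζ
    · simp [bernardiIntegrand]
    · simp [bernardiIntegrand, dslope_of_ne _ hζ, slope_def_field, hf0, hζ]
  have hmul : ∫ t in (0 : ℝ)..1, dslope f 0 (t * z) * ((t : ℂ) * z) ^ c =
      z ^ c * ∫ t in (0 : ℝ)..1, (t : ℂ) ^ c * dslope f 0 (t * z) := by
    rw [← intervalIntegral.integral_const_mul]
    congr 1 with t
    ring
  rw [bernardi, if_neg hz, segIntegral, hint, hmul]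
  field_simp

/-- For `−1 ≤ B < A ≤ 1` with `Re((1+Az)/(1+Bz)) > 0` on `𝔻` and
`c = 0, 1, 2, ⋯`, the Bernardi transform preserves the Janowski class `S*[A,B]`. -/
theorem bernardi_preserves_janowski (A B : ℝ) (hB : -1 ≤ B) (hBA : B < A) (hA : A ≤ 1)
    (hre : ∀ z ∈ ball (0 : ℂ) 1, 0 < ((1 + (A : ℂ) * z) / (1 + (B : ℂ) * z)).re)
    (c : ℕ)
    (f : ℂ → ℂ) (hf : AnalyticOnNhd ℂ f (ball 0 1)) (hf0 : f 0 = 0) (hf1 : deriv f 0 = 1)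
    (hsub : ∀ z ∈ ball (0 : ℂ) 1, z ≠ 0 →
      f z ≠ 0 ∧ z * deriv f z / f z ∈
        (fun w : ℂ => (1 + (A : ℂ) * w) / (1 + (B : ℂ) * w)) '' ball 0 1) :
    ∀ z ∈ ball (0 : ℂ) 1, z ≠ 0 →
      bernardi c f z ≠ 0 ∧ z * deriv (bernardi c f) z / bernardi c f z ∈
        (fun w : ℂ => (1 + (A : ℂ) * w) / (1 + (B : ℂ) * w)) '' ball 0 1 := by
  have hB2 : B ^ 2 ≤ 1 := by nlinarith
  have hrep (p : ℂ) (hp : janowskiForm A B p 1 < 0) : 0 < p.re := by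
    obtain ⟨w, hw, rfl⟩ := (mem_image_iff_janowskiForm_neg hB2 hBA p).2 hp
    exact hre w hw
  set g := dslope f 0 with hgdef
  have hg : DifferentiableOn ℂ g (ball 0 1) :=
    (differentiableOn_dslope (ball_mem_nhds 0 one_pos)).2 hf.differentiableOn
  have hfg (z : ℂ) : f z = z * g z := by
    simpa [hf0] using (sub_smul_dslope f 0 z).symm
  have hg0 : g 0 ≠ 0 := by simp [hgdef, hf1]
  have hgJ (z : ℂ) (hz : z ∈ ball (0 : ℂ) 1) :
      janowskiForm A B (g z + z * deriv g z) (g z) < 0 := by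
    rcases eq_or_ne z 0 with rfl | hz0
    · rw [zero_mul, add_zero, janowskiForm_self]
      exact neg_neg_of_pos (mul_pos (pow_pos (sub_pos.2 hBA) 2) (normSq_pos.2 hg0))
    · obtain ⟨hfz, hmem⟩ := hsub z hz hz0
      have hgz : g z ≠ 0 := fun h => hfz (by rw [hfg, h, mul_zero])
      have hd : deriv f z = g z + z * deriv g z := by
        rw [funext hfg]
        refine ((hasDerivAt_id z).mul
          (hg.differentiableAt (isOpen_ball.mem_nhds hz)).hasDerivAt).deriv.trans ?_
        simp
      rwa [hd, hfg, mul_div_mul_left _ _ hz0, mem_image_iff_janowskiForm_neg hB2 hBA,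
        janowskiForm_div_neg_iff hgz] at hmem
  set G : ℂ → ℂ := fun z => (1 + c) * ∫ t in (0 : ℝ)..1, (t : ℂ) ^ c * g (t * z) with hGdef
  have hGd (z : ℂ) (hz : z ∈ ball (0 : ℂ) 1) : HasDerivAt G
      ((1 + c) * ∫ t in (0 : ℝ)..1, (t : ℂ) ^ c * (t * deriv g (t * z))) z :=
    (hasDerivAt_integral_pow_mul_comp_mul hg c hz).const_mul _
  have hG : DifferentiableOn ℂ G (ball 0 1) := fun z hz =>
    (hGd z hz).differentiableAt.differentiableWithinAt
  have hode (z : ℂ) (hz : z ∈ ball (0 : ℂ) 1) :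
      (1 + (c : ℝ) : ℂ) * g z = (1 + (c : ℝ)) * G z + z * deriv G z := by
    rw [(hGd z hz).deriv, ← succ_mul_integral_add_mul_integral_deriv hg c hz, hGdef]
    push_cast
    ring
  intro z hz hz0
  have hform := janowskiForm_neg_of_briot_bouquet hB2 hBA hrep c.cast_nonneg hg0 hG hode hgJ z hz
  have hGz : G z ≠ 0 := ne_zero_of_janowskiForm_neg hB2 hform
  have hbG : bernardi c f = fun z => z * G z := funext (bernardi_eq hf0 c)
  have hd : deriv (bernardi c f) z = G z + z * deriv G z := by
    rw [hbG]
    refine ((hasDerivAt_id z).mul (hGd z hz).differentiableAt.hasDerivAt).deriv.trans ?_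
    simp
  rw [hd, hbG]
  refine ⟨mul_ne_zero hz0 hGz, ?_⟩
  rwa [mul_div_mul_left _ _ hz0, mem_image_iff_janowskiForm_neg hB2 hBA,
    janowskiForm_div_neg_iff hGz]
end
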